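/- arXiv:2405.01810 — 3 statements merged into one kernel-verified Lean document; each statement's English description precedes it below -/
import Mathlib

section
/- Let d, K be natural numbers and f : EuclideanSpace ℝ (Fin d) → ℝ be K-times continuously differentiable (ContDiff ℝ K f). Then the following are equivalent: (a) for all x, y, f y = ∑_{k=0}^{K} (k!)⁻¹ • (iteratedFDeriv ℝ k f x) applied to the constant tuple (y − x, …, y − x), i.e., f equals its K-th order multivariate Taylor expansion at every base point; (b) there exists p : MvPolynomial (Fin d) ℝ with p.totalDegree ≤ K such that for all y, f y = MvPolynomial.eval (fun i => y i) p. -/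
/-- The homogeneous polynomial attached to a continuous multilinear form on Euclidean space,
namely its evaluation on the diagonal. -/
noncomputable def ContinuousMultilinearMap.toMvPolynomial {d k : ℕ}
    (M : ContinuousMultilinearMap ℝ (fun _ : Fin k => EuclideanSpace ℝ (Fin d)) ℝ) :
    MvPolynomial (Fin d) ℝ :=
  ∑ r : Fin k → Fin d,
    M (fun j => EuclideanSpace.single (r j) 1) • ∏ j, MvPolynomial.X (r j)

theorem ContinuousMultilinearMap.totalDegree_toMvPolynomial_le {d k : ℕ}
    (M : ContinuousMultilinearMap ℝ (fun _ : Fin k => EuclideanSpace ℝ (Fin d)) ℝ) :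
    M.toMvPolynomial.totalDegree ≤ k := by
  refine MvPolynomial.totalDegree_finsetSum_le fun r _ => ?_
  refine (MvPolynomial.totalDegree_smul_le _ _).trans ?_
  refine (MvPolynomial.totalDegree_finsetProd _ _).trans ?_
  simp

theorem ContinuousMultilinearMap.eval_toMvPolynomial {d k : ℕ}
    (M : ContinuousMultilinearMap ℝ (fun _ : Fin k => EuclideanSpace ℝ (Fin d)) ℝ)
    (y : EuclideanSpace ℝ (Fin d)) :
    MvPolynomial.eval (fun i => y i) M.toMvPolynomial = M (fun _ => y) := by
  have hy : y = ∑ i, y i • EuclideanSpace.single i (1 : ℝ) := by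
    simpa using ((EuclideanSpace.basisFun (Fin d) ℝ).sum_repr y).symm
  conv_rhs => rw [hy]
  rw [M.map_sum]
  simp [toMvPolynomial, MvPolynomial.smul_eval, M.map_smul_univ, mul_comm]

theorem MvPolynomial.exists_polynomial_eval_line {σ : Type*} {K : ℕ} (p : MvPolynomial σ ℝ)
    (hp : p.totalDegree ≤ K) (x v : σ → ℝ) :
    ∃ q : Polynomial ℝ, q.natDegree ≤ K ∧
      ∀ t : ℝ, q.eval t = MvPolynomial.eval (fun i => x i + t * v i) p := by
  refine ⟨aeval (fun i => Polynomial.C (v i) * Polynomial.X + Polynomial.C (x i)) p, ?_, ?_⟩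
  · simpa using aeval_natDegree_le p hp _ fun i => Polynomial.natDegree_linear_le
  · intro t
    have h : ((Polynomial.aeval t : Polynomial ℝ →ₐ[ℝ] ℝ).comp
        (aeval fun i => Polynomial.C (v i) * Polynomial.X + Polynomial.C (x i))) =
        aeval fun i => x i + t * v i := by
      ext i
      simp only [AlgHom.comp_apply, aeval_X, map_add, map_mul, Polynomial.aeval_C, Polynomial.aeval_X,
        Algebra.algebraMap_self, RingHom.id_apply]
      ring
    simpa [Polynomial.coe_aeval_eq_eval, MvPolynomial.aeval_eq_eval] using DFunLike.congr_fun h p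

theorem ContDiff.iteratedFDeriv_line_eq_iterate_derivative {E : Type*} [NormedAddCommGroup E]
    [NormedSpace ℝ E] {f : E → ℝ} (hf : ∀ n : ℕ, ContDiff ℝ n f) {x v : E} {q : Polynomial ℝ}
    (hq : ∀ t : ℝ, f (x + t • v) = q.eval t) (n : ℕ) (t : ℝ) :
    iteratedFDeriv ℝ n f (x + t • v) (fun _ => v) = (Polynomial.derivative^[n] q).eval t := by
  induction n generalizing t with
  | zero => simpa using hq t
  | succ n ih =>
    rw [← ContDiffAt.deriv_fderiv_add_smul (by exact_mod_cast (hf (n + 1)).contDiffAt), funext ih,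
      Polynomial.deriv, Function.iterate_succ_apply']

theorem MvPolynomial.contDiff_eval_euclideanSpace {d : ℕ} {n : WithTop ℕ∞}
    (p : MvPolynomial (Fin d) ℝ) :
    ContDiff ℝ n fun y : EuclideanSpace ℝ (Fin d) => eval (fun i => y i) p := by
  simp only [MvPolynomial.eval_eq]
  fun_prop

theorem best_response_iff_polynomial (d K : ℕ)
    (f : EuclideanSpace ℝ (Fin d) → ℝ) (hf : ContDiff ℝ K f) :
    (∀ x y : EuclideanSpace ℝ (Fin d),
        f y = ∑ k ∈ Finset.range (K + 1),
          ((Nat.factorial k : ℝ))⁻¹ • (iteratedFDeriv ℝ k f x (fun _ => y - x)))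
      ↔
    (∃ p : MvPolynomial (Fin d) ℝ, p.totalDegree ≤ K ∧
        ∀ y : EuclideanSpace ℝ (Fin d), f y = MvPolynomial.eval (fun i => y i) p) := by
  constructor
  · intro h
    refine ⟨∑ k ∈ Finset.range (K + 1),
      (Nat.factorial k : ℝ)⁻¹ • (iteratedFDeriv ℝ k f 0).toMvPolynomial, ?_, fun y => ?_⟩
    · refine MvPolynomial.totalDegree_finsetSum_le fun k hk => ?_
      refine (MvPolynomial.totalDegree_smul_le _ _).trans ?_
      exact (ContinuousMultilinearMap.totalDegree_toMvPolynomial_le _).trans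
        (Finset.mem_range_succ_iff.mp hk)
    · simp only [map_sum, MvPolynomial.smul_eval, ContinuousMultilinearMap.eval_toMvPolynomial]
      simpa using h 0 y
  · rintro ⟨p, hp, hfp⟩ x y
    have hsmooth (n : ℕ) : ContDiff ℝ n f := by
      rw [funext hfp]
      exact p.contDiff_eval_euclideanSpace
    obtain ⟨q, hqK, hq⟩ := p.exists_polynomial_eval_line hp (fun i => x i) (fun i => (y - x) i)
    have hline (t : ℝ) : f (x + t • (y - x)) = q.eval t := by
      rw [hfp, hq]
      simp
    have hzero (t : ℝ) : iteratedFDeriv ℝ (K + 1) f (x + t • (y - x)) (fun _ => y - x) = 0 := by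
      rw [ContDiff.iteratedFDeriv_line_eq_iterate_derivative hsmooth hline,
        Polynomial.iterate_derivative_eq_zero (Nat.lt_succ_of_le hqK), Polynomial.eval_zero]
    have htaylor := map_add_eq_sum_add_integral_iteratedFDeriv (f := f) (x := x) (y := y - x)
      (n := K) fun t _ => by exact_mod_cast (hsmooth (K + 1)).contDiffAt
    simpa [hzero] using htaylor
end

section
/- Let d be a natural number, h, f : EuclideanSpace ℝ (Fin d) → ℝ with h differentiable everywhere and f differentiable at a point x, and let λ > 0. Write e_i = EuclideanSpace.single i 1 for the i-th standard basis vector. If for every z ∈ EuclideanSpace ℝ (Fin d) and every i ∈ Fin d one has (fderiv ℝ h z e_i) * (fderiv ℝ f x e_i) ≥ 0, then h (x + (2λ)⁻¹ • gradient f x) ≥ h x. -/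
/-- A differentiable function whose derivative along `v` is everywhere nonnegative does not
decrease when moving by a nonnegative multiple of `v`. -/
theorem Differentiable.le_add_smul_of_fderiv_nonneg {E : Type*} [NormedAddCommGroup E]
    [NormedSpace ℝ E] {h : E → ℝ} (hh : Differentiable ℝ h) {v : E}
    (hv : ∀ z, 0 ≤ fderiv ℝ h z v) (x : E) {t : ℝ} (ht : 0 ≤ t) :
    h x ≤ h (x + t • v) := by
  have hd : ∀ s : ℝ, HasDerivAt (fun s : ℝ => h (x + s • v)) (fderiv ℝ h (x + s • v) v) s := by
    intro s
    have hline : HasDerivAt (fun s : ℝ => x + s • v) v s := by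
      simpa using ((hasDerivAt_id s).smul_const v).const_add x
    exact (hh (x + s • v)).hasFDerivAt.comp_hasDerivAt s hline
  have hmono : Monotone fun s : ℝ => h (x + s • v) :=
    monotone_of_deriv_nonneg (fun s => (hd s).differentiableAt)
      fun s => (hd s).deriv ▸ hv (x + s • v)
  simpa using hmono ht

theorem EuclideanSpace.gradient_apply {ι : Type*} [Fintype ι] [DecidableEq ι]
    (f : EuclideanSpace ℝ ι → ℝ) (x : EuclideanSpace ℝ ι) (i : ι) :
    gradient f x i = fderiv ℝ f x (EuclideanSpace.single i 1) := by
  rw [← inner_gradient_left, EuclideanSpace.inner_single_right]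
  simp

theorem EuclideanSpace.map_eq_sum_single {ι : Type*} [Fintype ι] [DecidableEq ι]
    (L : EuclideanSpace ℝ ι →L[ℝ] ℝ) (v : EuclideanSpace ℝ ι) :
    L v = ∑ i, L (EuclideanSpace.single i 1) * v i := by
  conv_lhs => rw [← (EuclideanSpace.basisFun ι ℝ).sum_repr v]
  simp [mul_comm]

theorem safety_of_aligned_gradients (d : ℕ)
    (h f : EuclideanSpace ℝ (Fin d) → ℝ)
    (hh : Differentiable ℝ h) (x : EuclideanSpace ℝ (Fin d))
    (hfx : DifferentiableAt ℝ f x)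
    (lam : ℝ) (hlam : 0 < lam)
    (halign : ∀ z : EuclideanSpace ℝ (Fin d), ∀ i : Fin d,
      (fderiv ℝ h z (EuclideanSpace.single i 1)) * (fderiv ℝ f x (EuclideanSpace.single i 1)) ≥ 0) :
    h (x + (2 * lam)⁻¹ • gradient f x) ≥ h x := by
  refine hh.le_add_smul_of_fderiv_nonneg (fun z => ?_) x (by positivity)
  rw [EuclideanSpace.map_eq_sum_single]
  refine Finset.sum_nonneg fun i _ => ?_
  rw [EuclideanSpace.gradient_apply]
  exact halign z i
end

section
/- Let h : ℝ → ℝ be h t = −4·t·(t − 1). For every x ∈ ℝ: (a) the function g y = h x + (deriv h x) * (y − x) − (y − x)² attains its maximum uniquely at y = 2 − 3x; (b) h (2 − 3x) − h x = −8·(2x − 1)²; and hence (c) h (2 − 3x) ≤ h x, with equality if and only if x = 1/2. -/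
theorem example2_general (x : ℝ) :
    ((∀ y : ℝ,
        (-4 * x * (x - 1)) + (deriv (fun t : ℝ => -4 * t * (t - 1)) x) * (y - x) - (y - x) ^ 2
          ≤ (-4 * x * (x - 1)) + (deriv (fun t : ℝ => -4 * t * (t - 1)) x) * ((2 - 3 * x) - x)
              - ((2 - 3 * x) - x) ^ 2) ∧
      (∀ y : ℝ, y ≠ 2 - 3 * x →
        (-4 * x * (x - 1)) + (deriv (fun t : ℝ => -4 * t * (t - 1)) x) * (y - x) - (y - x) ^ 2
          < (-4 * x * (x - 1)) + (deriv (fun t : ℝ => -4 * t * (t - 1)) x) * ((2 - 3 * x) - x)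
              - ((2 - 3 * x) - x) ^ 2)) ∧
    (-4 * (2 - 3 * x) * ((2 - 3 * x) - 1)) - (-4 * x * (x - 1)) = -8 * (2 * x - 1) ^ 2 ∧
    ((-4 * (2 - 3 * x) * ((2 - 3 * x) - 1)) ≤ (-4 * x * (x - 1)) ∧
      ((-4 * (2 - 3 * x) * ((2 - 3 * x) - 1)) = (-4 * x * (x - 1)) ↔ x = 1 / 2)) := by
  have hderiv : deriv (fun t : ℝ => -4 * t * (t - 1)) x = 4 - 8 * x := by
    have h := ((hasDerivAt_id' x).const_mul (-4)).mul ((hasDerivAt_id' x).sub_const 1)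
    refine HasDerivAt.deriv (h.congr_deriv ?_)
    ring
  rw [hderiv]
  refine ⟨⟨fun y => ?_, fun y hy => ?_⟩, by ring, ?_, fun h => ?_, fun h => ?_⟩
  · linarith [sq_nonneg (y - (2 - 3 * x))]
  · linarith [sq_pos_of_ne_zero (sub_ne_zero.mpr hy)]
  · linarith [sq_nonneg (2 * x - 1)]
  · have hsq : (2 * x - 1) ^ 2 = 0 := by linarith
    linarith [pow_eq_zero_iff two_ne_zero |>.mp hsq]
  · subst h
    norm_num
end
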